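/- Let A > 0, let η, η₀ : (0, ∞) → ℝ satisfy 0 < η(ε) < 1 and 0 < η₀(ε) < 1 for all ε > 0, with ε·log η₀(ε) → 0 and 1/(ε·log η(ε)) → −A as ε → 0⁺, and set μ(ε) = −A − 1/(ε log η(ε)) and μ̃(ε) = −A − 1/(ε log(η₀(ε)η(ε))). Let L, a, b be real constants and let λ_*, λ, λ^*, r_*, r^* : (0, ∞) → ℝ be functions such that: (i) λ_*(ε) ≤ λ(ε) ≤ λ^*(ε) for all ε > 0; (ii) λ_*(ε) = L + a μ̃(ε) + b ε² + r_*(ε) with r_*(ε)/(|μ̃(ε)| + ε²) → 0 as ε → 0⁺; and (iii) λ^*(ε) = L + a μ(ε) + b ε² + r^*(ε) with r^*(ε)/(|μ(ε)| + ε²) → 0 as ε → 0⁺. Then there exist constants C > 0 and ε₀ > 0 such that for all ε ∈ (0, ε₀): −C(|μ(ε)| + ε² + |ε log η₀(ε)|) ≤ λ(ε) − L ≤ C(|μ(ε)| + ε²). -/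

import Mathlib

open Real Filter

lemma squeeze_aux (a b m e r : ℝ) (he : 0 < e) (h : |r / (|m| + e ^ 2)| < 1) :
    |a * m + b * e ^ 2 + r| ≤ (|a| + |b| + 1) * (|m| + e ^ 2) := by
  have hp : 0 < |m| + e ^ 2 := by positivity
  rw [abs_div, abs_of_pos hp, div_lt_one hp] at h
  have h1 : |a * m + b * e ^ 2 + r| ≤ |a| * |m| + |b| * e ^ 2 + |r| := by
    calc _ ≤ |a * m| + |b * e ^ 2| + |r| := abs_add_three _ _ _
      _ = _ := by rw [abs_mul, abs_mul, abs_of_nonneg (sq_nonneg e)]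
  have h2 : 0 ≤ |a| * e ^ 2 := by positivity
  have h3 : 0 ≤ |b| * |m| := by positivity
  nlinarith

/-- the squeeze argument of Theorem 2. -/
theorem theorem2_squeeze (A : ℝ) (hA : 0 < A) (η η₀ : ℝ → ℝ)
    (hη : ∀ ε > 0, 0 < η ε ∧ η ε < 1)
    (hη₀ : ∀ ε > 0, 0 < η₀ ε ∧ η₀ ε < 1)
    (hη₀lim : Tendsto (fun ε => ε * Real.log (η₀ ε)) (nhdsWithin 0 (Set.Ioi 0)) (nhds 0))
    (hηlim : Tendsto (fun ε => 1 / (ε * Real.log (η ε)))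
      (nhdsWithin 0 (Set.Ioi 0)) (nhds (-A)))
    (μ μt : ℝ → ℝ)
    (hμ : ∀ ε > 0, μ ε = -A - 1 / (ε * Real.log (η ε)))
    (hμt : ∀ ε > 0, μt ε = -A - 1 / (ε * Real.log (η₀ ε * η ε)))
    (L a b : ℝ) (lamStar lam lamUp rStar rUp : ℝ → ℝ)
    (hsq : ∀ ε > 0, lamStar ε ≤ lam ε ∧ lam ε ≤ lamUp ε)
    (hasymStar : ∀ ε > 0, lamStar ε = L + a * μt ε + b * ε ^ 2 + rStar ε)
    (hrStar : Tendsto (fun ε => rStar ε / (|μt ε| + ε ^ 2))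
      (nhdsWithin 0 (Set.Ioi 0)) (nhds 0))
    (hasymUp : ∀ ε > 0, lamUp ε = L + a * μ ε + b * ε ^ 2 + rUp ε)
    (hrUp : Tendsto (fun ε => rUp ε / (|μ ε| + ε ^ 2))
      (nhdsWithin 0 (Set.Ioi 0)) (nhds 0)) :
    ∃ C > 0, ∃ ε₀ > 0, ∀ ε, 0 < ε → ε < ε₀ →
      -C * (|μ ε| + ε ^ 2 + |ε * Real.log (η₀ ε)|) ≤ lam ε - L ∧
      lam ε - L ≤ C * (|μ ε| + ε ^ 2) := by
  have e1 := (hrStar.abs).eventually (gt_mem_nhds (by simp : |(0:ℝ)| < 1))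
  have e2 := (hrUp.abs).eventually (gt_mem_nhds (by simp : |(0:ℝ)| < 1))
  have e3 := hηlim.eventually (lt_mem_nhds (by linarith : -(A + 1) < -A))
  obtain ⟨ε₀, hε₀, H⟩ := mem_nhdsGT_iff_exists_Ioo_subset.1 (e1.and (e2.and e3))
  have hM : 0 < |a| + |b| + 1 := by positivity
  have hK : 1 ≤ (A + 1) ^ 2 := by nlinarith
  refine ⟨(|a| + |b| + 1) * (A + 1) ^ 2, by positivity, ε₀, hε₀, fun ε hε hlt => ?_⟩
  obtain ⟨h1, h2, h3⟩ := H ⟨hε, hlt⟩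
  have b1 := squeeze_aux a b _ _ _ hε h1
  have b2 := squeeze_aux a b _ _ _ hε h2
  have hx : ε * Real.log (η ε) < 0 :=
    mul_neg_of_pos_of_neg hε (Real.log_neg (hη ε hε).1 (hη ε hε).2)
  have hy : ε * Real.log (η₀ ε) < 0 :=
    mul_neg_of_pos_of_neg hε (Real.log_neg (hη₀ ε hε).1 (hη₀ ε hε).2)
  have hm : |μt ε| ≤ |μ ε| + (A + 1) ^ 2 * |ε * Real.log (η₀ ε)| := by
    have m1 := hμ ε hε
    have m2 := hμt ε hε
    rw [Real.log_mul (hη₀ ε hε).1.ne' (hη ε hε).1.ne', mul_add] at m2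
    generalize ε * Real.log (η ε) = x at *
    generalize ε * Real.log (η₀ ε) = y at *
    have hd : μt ε - μ ε = (1 / x) * (1 / (y + x)) * y := by
      rw [m1, m2]
      have : y + x ≠ 0 := by linarith
      have := hx.ne
      field_simp
      ring
    have k1 : |1 / x| ≤ A + 1 := by
      rw [abs_of_neg (one_div_neg.2 hx)]; linarith
    have k2 : |1 / (y + x)| ≤ A + 1 := by
      rw [abs_of_neg (one_div_neg.2 (by linarith))]
      have := one_div_le_one_div_of_neg_of_le hx (by linarith : y + x ≤ x)
      linarith
    have k3 : |μt ε - μ ε| ≤ (A + 1) ^ 2 * |y| := by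
      rw [hd, abs_mul, abs_mul, sq]
      gcongr
    have := abs_sub_abs_le_abs_sub (μt ε) (μ ε)
    linarith
  have s1 := hsq ε hε
  rw [hasymStar ε hε, hasymUp ε hε] at s1
  have hy0 := abs_nonneg (ε * Real.log (η₀ ε))
  have hp : 0 ≤ |μ ε| + ε ^ 2 := by positivity
  have hKp : |μ ε| + ε ^ 2 ≤ (A + 1) ^ 2 * (|μ ε| + ε ^ 2) := le_mul_of_one_le_left hp hK
  constructor
  · have : |μt ε| + ε ^ 2 ≤ (A + 1) ^ 2 * (|μ ε| + ε ^ 2 + |ε * Real.log (η₀ ε)|) := by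
      linarith
    have := mul_le_mul_of_nonneg_left this hM.le
    have := (abs_le.1 b1).1
    linarith
  · have := mul_le_mul_of_nonneg_left hKp hM.le
    have := (abs_le.1 b2).2
    linarith
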